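/- There exists a unique λ ∈ (0, π/(2√2)) satisfying λ·tanh λ = √2·λ·cot(√2·λ) (equivalently tanh λ · sin(√2·λ) = √2·cos(√2·λ)), and the corresponding eigenvalue σ = λ·tanh λ satisfies 0.5315 < σ < 0.5316. -/

import Mathlib

lemma aux_mono {f f' : ℝ → ℝ} (h0 : f 0 = 0) (hd : ∀ x, HasDerivAt f (f' x) x)
    (hp : ∀ x, 0 ≤ x → 0 ≤ f' x) : ∀ x, 0 ≤ x → 0 ≤ f x := by
  intro x hx
  have hm : MonotoneOn f (Set.Ici 0) := by
    apply monotoneOn_of_deriv_nonneg (convex_Ici 0)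
    · exact fun y _ => (hd y).continuousAt.continuousWithinAt
    · exact fun y _ => (hd y).differentiableAt.differentiableWithinAt
    · intro y hy
      rw [interior_Ici] at hy
      rw [(hd y).deriv]
      exact hp y (le_of_lt hy)
  have := hm (Set.mem_Ici.2 le_rfl) (Set.mem_Ici.2 hx) hx
  rwa [h0] at this

/-- antiderivative of a monomial -/
lemma aux_pow (n : ℕ) (x : ℝ) :
    HasDerivAt (fun y : ℝ => y ^ (n+1) / ((n+1).factorial : ℝ)) (x ^ n / (n.factorial : ℝ)) x := by
  have h := (hasDerivAt_pow (n+1) x).div_const ((n+1).factorial : ℝ)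
  refine h.congr_deriv ?_
  have : (n.factorial : ℝ) ≠ 0 := by positivity
  have h2 : ((n:ℝ)+1) ≠ 0 := by positivity
  rw [Nat.factorial_succ]
  push_cast
  field_simp

noncomputable def cT (n : ℕ) (x : ℝ) : ℝ :=
  ∑ k ∈ Finset.range n, (-1) ^ k * (x ^ (2*k) / ((2*k).factorial : ℝ))
noncomputable def sT (n : ℕ) (x : ℝ) : ℝ :=
  ∑ k ∈ Finset.range n, (-1) ^ k * (x ^ (2*k+1) / ((2*k+1).factorial : ℝ))

lemma sT_deriv (n : ℕ) (x : ℝ) : HasDerivAt (sT n) (cT n x) x := by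
  unfold sT cT
  apply HasDerivAt.fun_sum
  intro k _
  exact (aux_pow (2*k) x).const_mul _

lemma cT_deriv (n : ℕ) (x : ℝ) : HasDerivAt (cT (n+1)) (-sT n x) x := by
  have : cT (n+1) = fun y => (∑ k ∈ Finset.range n,
      (-1) ^ (k+1) * (y ^ (2*k+1+1) / ((2*k+1+1).factorial : ℝ))) + 1 := by
    funext y
    unfold cT
    rw [Finset.sum_range_succ']
    simp [mul_add]
  rw [this]
  unfold sT
  rw [← Finset.sum_neg_distrib]
  apply HasDerivAt.add_const
  apply HasDerivAt.fun_sum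
  intro k _
  refine ((aux_pow (2*k+1) x).const_mul ((-1:ℝ)^(k+1))).congr_deriv ?_
  ring

lemma sT_zero (n : ℕ) : sT n 0 = 0 := by simp [sT]
lemma cT_zero (n : ℕ) : cT (n+1) 0 = 1 := by
  unfold cT
  rw [Finset.sum_range_succ']
  simp

lemma main_bd (n : ℕ) :
    (∀ x, 0 ≤ x → 0 ≤ (-1)^n * (cT (n+1) x - Real.cos x)) ∧
    (∀ x, 0 ≤ x → 0 ≤ (-1)^n * (sT (n+1) x - Real.sin x)) := by
  have key : ∀ n : ℕ, (∀ x, 0 ≤ x → 0 ≤ (-1)^n * (cT (n+1) x - Real.cos x)) →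
    (∀ x, 0 ≤ x → 0 ≤ (-1:ℝ)^n * (sT (n+1) x - Real.sin x)) := by
    intro n h
    refine aux_mono (f := fun x => (-1)^n * (sT (n+1) x - Real.sin x)) (by simp [sT_zero])
      (fun x => ((sT_deriv (n+1) x).sub (Real.hasDerivAt_sin x)).const_mul _) h
  have key2 : ∀ n : ℕ, (∀ x, 0 ≤ x → 0 ≤ (-1)^n * (sT (n+1) x - Real.sin x)) →
    (∀ x, 0 ≤ x → 0 ≤ (-1:ℝ)^(n+1) * (cT (n+1+1) x - Real.cos x)) := by
    intro n h
    refine aux_mono (f := fun x => (-1)^(n+1) * (cT (n+1+1) x - Real.cos x)) (by simp [cT_zero])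
      (fun x => ((cT_deriv (n+1) x).sub (Real.hasDerivAt_cos x)).const_mul _) ?_
    intro x hx
    have := h x hx
    rw [pow_succ]
    linarith
  induction n with
  | zero =>
    have h0 : ∀ x : ℝ, 0 ≤ x → 0 ≤ (-1)^0 * (cT (0+1) x - Real.cos x) := by
      intro x _
      simp [cT, Real.cos_le_one]
    exact ⟨h0, key 0 h0⟩
  | succ n ih =>
    exact ⟨key2 n ih.2, key (n+1) (key2 n ih.2)⟩

lemma tanh_form (x : ℝ) : Real.tanh x = 1 - 2 / (Real.exp x ^ 2 + 1) := by
  rw [Real.tanh_eq, Real.exp_neg]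
  have := Real.exp_pos x
  field_simp
  ring

lemma tanh_lt' {x y : ℝ} (h : x < y) : Real.tanh x < Real.tanh y := by
  rw [tanh_form, tanh_form]
  have h1 := Real.exp_lt_exp.2 h
  have := Real.exp_pos x
  gcongr

lemma tanh_gt_of {x t l : ℝ} (ht : t < 1) (hl0 : 0 ≤ l) (hl : l ≤ Real.exp x)
    (h : (1 + t) < l^2 * (1 - t)) : t < Real.tanh x := by
  rw [tanh_form]
  have h2 : l^2 ≤ Real.exp x ^ 2 := by gcongr
  have : 2 / (Real.exp x ^ 2 + 1) < 1 - t := by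
    rw [div_lt_iff₀ (by positivity)]
    nlinarith
  linarith

lemma tanh_lt_of {x t u : ℝ} (ht : t < 1) (hu : Real.exp x ≤ u)
    (h : u^2 * (1 - t) < 1 + t) : Real.tanh x < t := by
  rw [tanh_form]
  have h2 : Real.exp x ^ 2 ≤ u^2 := by gcongr
  have : 1 - t < 2 / (Real.exp x ^ 2 + 1) := by
    rw [lt_div_iff₀ (by positivity)]
    nlinarith
  linarith

lemma tanh_a : 0.664171 < Real.tanh 0.800247 ∧ Real.tanh 0.800247 < 0.66418 := by
  have hb := abs_le.1 (Real.exp_bound (x := 0.800247) (by norm_num [abs_le]) (n := 10) (by norm_num))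
  rw [abs_of_pos (by norm_num : (0:ℝ) < 0.800247)] at hb
  norm_num [Finset.sum_range_succ, Nat.factorial] at hb
  constructor
  · exact tanh_gt_of (l := 2.22609) (by norm_num) (by norm_num) (by norm_num; linarith) (by norm_num)
  · exact tanh_lt_of (u := 2.2261) (by norm_num) (by norm_num; linarith) (by norm_num)

lemma tanh_b : 0.66415 < Real.tanh 0.8003 ∧ Real.tanh 0.8003 < 0.66425 := by
  have hb := abs_le.1 (Real.exp_bound (x := 0.8003) (by norm_num [abs_le]) (n := 10) (by norm_num))
  rw [abs_of_pos (by norm_num : (0:ℝ) < 0.8003)] at hb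
  norm_num [Finset.sum_range_succ, Nat.factorial] at hb
  constructor
  · exact tanh_gt_of (l := 2.2261) (by norm_num) (by norm_num) (by norm_num; linarith) (by norm_num)
  · exact tanh_lt_of (u := 2.2263) (by norm_num) (by norm_num; linarith) (by norm_num)

lemma cT_sqrt (n : ℕ) (a : ℝ) : cT n (Real.sqrt 2 * a) =
    ∑ k ∈ Finset.range n, (-1) ^ k * ((2 * a^2) ^ k / ((2*k).factorial : ℝ)) := by
  unfold cT
  apply Finset.sum_congr rfl
  intro k _
  rw [pow_mul, mul_pow, Real.sq_sqrt (by norm_num)]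

lemma sT_sqrt (n : ℕ) (a : ℝ) : sT n (Real.sqrt 2 * a) = Real.sqrt 2 * (a *
    ∑ k ∈ Finset.range n, (-1) ^ k * ((2 * a^2) ^ k / ((2*k+1).factorial : ℝ))) := by
  unfold sT
  rw [Finset.mul_sum, Finset.mul_sum]
  apply Finset.sum_congr rfl
  intro k _
  rw [pow_succ, pow_mul, mul_pow, Real.sq_sqrt (by norm_num)]
  ring

noncomputable def F19 (l : ℝ) : ℝ :=
  Real.tanh l * Real.sin (Real.sqrt 2 * l) - Real.sqrt 2 * Real.cos (Real.sqrt 2 * l)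

lemma F_a : F19 0.800247 < 0 := by
  have hs : 0 < Real.sqrt 2 := by positivity
  have h1 := (main_bd 5).1 (Real.sqrt 2 * 0.800247) (by positivity)
  have h2 := (main_bd 4).2 (Real.sqrt 2 * 0.800247) (by positivity)
  rw [cT_sqrt] at h1
  rw [sT_sqrt] at h2
  have hc : 0.425103 ≤ Real.cos (Real.sqrt 2 * 0.800247) := by
    norm_num [Finset.sum_range_succ, Nat.factorial] at h1 ⊢
    linarith
  have hsn : Real.sin (Real.sqrt 2 * 0.800247) ≤ Real.sqrt 2 * 0.640035 := by
    refine le_trans (by linarith [h2] : _ ≤ Real.sqrt 2 * (0.800247 *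
      ∑ k ∈ Finset.range (4+1), (-1) ^ k * ((2 * 0.800247^2) ^ k / ((2*k+1).factorial : ℝ)))) ?_
    gcongr
    norm_num [Finset.sum_range_succ, Nat.factorial]
  have ht := tanh_a
  unfold F19
  have : Real.tanh 0.800247 * Real.sin (Real.sqrt 2 * 0.800247) ≤
      0.66418 * (Real.sqrt 2 * 0.640035) := by
    have ht0 : 0 ≤ Real.tanh 0.800247 := by linarith [ht.1]
    calc _ ≤ Real.tanh 0.800247 * (Real.sqrt 2 * 0.640035) := by gcongr
      _ ≤ _ := by gcongr; exact ht.2.le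
  nlinarith

lemma F_b : 0 < F19 0.8003 := by
  have hs : 0 < Real.sqrt 2 := by positivity
  have h1 := (main_bd 4).1 (Real.sqrt 2 * 0.8003) (by positivity)
  have h2 := (main_bd 3).2 (Real.sqrt 2 * 0.8003) (by positivity)
  rw [cT_sqrt] at h1
  rw [sT_sqrt] at h2
  have hc : Real.cos (Real.sqrt 2 * 0.8003) ≤ 0.425037 := by
    norm_num [Finset.sum_range_succ, Nat.factorial] at h1 ⊢
    linarith
  have hsn : Real.sqrt 2 * 0.64005 ≤ Real.sin (Real.sqrt 2 * 0.8003) := by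
    refine le_trans ?_ (by linarith [h2] : Real.sqrt 2 * (0.8003 *
      ∑ k ∈ Finset.range (3+1), (-1) ^ k * ((2 * 0.8003^2) ^ k / ((2*k+1).factorial : ℝ))) ≤ _)
    gcongr
    norm_num [Finset.sum_range_succ, Nat.factorial]
  have ht := tanh_b
  unfold F19
  have : 0.66415 * (Real.sqrt 2 * 0.64005) ≤
      Real.tanh 0.8003 * Real.sin (Real.sqrt 2 * 0.8003) := by
    have ht0 : 0 ≤ Real.tanh 0.8003 := by linarith [ht.1]
    calc _ ≤ Real.tanh 0.8003 * (Real.sqrt 2 * 0.64005) := by gcongr; exact ht.1.le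
      _ ≤ _ := by gcongr
  nlinarith

lemma F_mono {x y : ℝ} (hx : 0 < x) (hxy : x < y) (hy : y < Real.pi / (2 * Real.sqrt 2)) :
    F19 x < F19 y := by
  have hs : 0 < Real.sqrt 2 := by positivity
  have hy' : Real.sqrt 2 * y < Real.pi / 2 := by
    rw [lt_div_iff₀ (by positivity)] at hy
    linarith
  have hxy' : Real.sqrt 2 * x < Real.sqrt 2 * y := by gcongr
  have hx' : 0 < Real.sqrt 2 * x := by positivity
  have h1 := Real.sin_lt_sin_of_lt_of_le_pi_div_two (by linarith) hy'.le hxy'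
  have h2 := Real.cos_lt_cos_of_nonneg_of_le_pi_div_two hx'.le hy'.le hxy'
  have h3 := tanh_lt' hxy
  have h4 : 0 < Real.tanh x := by simpa using tanh_lt' hx
  have h5 : 0 < Real.sin (Real.sqrt 2 * x) := Real.sin_pos_of_pos_of_lt_pi hx' (by linarith)
  have h6 := mul_lt_mul'' h3 h1 h4.le h5.le
  have h7 := mul_lt_mul_of_pos_left h2 hs
  unfold F19
  linarith

lemma b_lt : (0.8003 : ℝ) < Real.pi / (2 * Real.sqrt 2) := by
  rw [lt_div_iff₀ (by positivity)]
  have : Real.sqrt 2 < 1.5 := by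
    rw [Real.sqrt_lt' (by norm_num)]
    norm_num
  linarith [Real.pi_gt_three]

lemma F_cont : Continuous F19 := by
  have : Continuous Real.tanh := by
    have h : Real.tanh = fun x => 1 - 2 / (Real.exp x ^ 2 + 1) := funext tanh_form
    rw [h]
    exact continuous_const.sub (continuous_const.div (by fun_prop) (fun x => by positivity))
  unfold F19
  fun_prop

theorem stmt_19 :
    (∃! l : ℝ, l ∈ Set.Ioo 0 (Real.pi / (2 * Real.sqrt 2)) ∧
      Real.tanh l * Real.sin (Real.sqrt 2 * l) = Real.sqrt 2 * Real.cos (Real.sqrt 2 * l)) ∧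
    (∀ l ∈ Set.Ioo 0 (Real.pi / (2 * Real.sqrt 2)),
      Real.tanh l * Real.sin (Real.sqrt 2 * l) = Real.sqrt 2 * Real.cos (Real.sqrt 2 * l) →
      0.5315 < l * Real.tanh l ∧ l * Real.tanh l < 0.5316) := by
  have hb := b_lt
  constructor
  · obtain ⟨l, hl, hl0⟩ := intermediate_value_Icc (by norm_num : (0.800247:ℝ) ≤ 0.8003)
      F_cont.continuousOn ⟨F_a.le, F_b.le⟩
    have hlm : l ∈ Set.Ioo 0 (Real.pi / (2 * Real.sqrt 2)) :=
      ⟨by linarith [hl.1], by linarith [hl.2]⟩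
    refine ⟨l, ⟨hlm, by unfold F19 at hl0; linarith⟩, ?_⟩
    rintro m ⟨hm, hm0⟩
    have hm1 : F19 m = 0 := by unfold F19; linarith
    rcases lt_trichotomy m l with h | h | h
    · have := F_mono hm.1 h hlm.2
      linarith
    · exact h
    · have := F_mono hlm.1 h hm.2
      linarith
  · intro l hl hl0
    have hl1 : F19 l = 0 := by unfold F19; linarith
    have ha : 0.800247 < l := by
      by_contra! h
      rcases h.lt_or_eq with h | h
      · have := F_mono hl.1 h (by linarith)
        linarith [F_a]
      · have := F_a
        rw [← h] at this
        linarith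
    have hlb : l < 0.8003 := by
      by_contra! h
      rcases h.lt_or_eq with h | h
      · have := F_mono (by norm_num) h hl.2
        linarith [F_b]
      · have := F_b
        rw [h] at this
        linarith
    have h1 := tanh_lt' ha
    have h2 := tanh_lt' hlb
    have h3 := tanh_a.1
    have h4 := tanh_b.2
    constructor <;> nlinarith
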